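/- Let T = (Q, Q₀, A, rewards, δ) be a task and π a policy. For every state q ∈ forward(π) \ backward(π), the set δ(q, π(q)) intersects forward(π) \ backward(π); that is, δ(q, π(q)) ∩ (forward(π) \ backward(π)) ≠ ∅. -/

import Mathlib

/-!
Formalization of the navigational reinforcement learning framework of
Ameloot & Van den Bussche, "On the convergence of cycle detection for
navigational reinforcement learning".
-/

/-- A task `T = (Q, Q₀, A, rewards, δ)`: `Q` and `A` are (finite, nonempty) types,
`start` is a nonempty set of start states, `rewards` a nonempty set of
state-action pairs and `delta` maps each state-action pair to a nonempty
set of successor states. -/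
structure NavTask (Q A : Type) where
  start : Set Q
  start_nonempty : start.Nonempty
  rewards : Set (Q × A)
  rewards_nonempty : rewards.Nonempty
  delta : Q → A → Set Q
  delta_nonempty : ∀ q a, (delta q a).Nonempty

namespace NavTask

variable {Q A : Type}

/-- The goal states of a task. -/
def goals (T : NavTask Q A) : Set Q := {q | ∃ a, (q, a) ∈ T.rewards}

/-- The reducibility layers relative to a set `S`; `layers S 0` is the layer `F₁ = S`
of the paper, and `layers S n` is the layer `F_{n+1}`. -/
def layers (T : NavTask Q A) (S : Set Q) : ℕ → Set Q
  | 0 => S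
  | n + 1 => T.layers S n ∪ {q | ∃ a, T.delta q a ⊆ T.layers S n}

/-- `S'` is reducible to `S`. -/
def ReducibleTo (T : NavTask Q A) (S' S : Set Q) : Prop := S' ⊆ ⋃ n, T.layers S n

/-- `reduce T`: the set of states reducible to the goal states. -/
def reduce (T : NavTask Q A) : Set Q := ⋃ n, T.layers T.goals n

/-- A task is reducible if all states are reducible to the goal states. -/
def Reducible (T : NavTask Q A) : Prop := T.ReducibleTo Set.univ T.goals

end NavTask

/-- A configuration `(q, π, V)`: current state, policy, working memory. -/
structure Config (Q A : Type) where
  state : Q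
  pol : Q → A
  mem : Set Q

namespace Config

variable {Q A : Type}

/-- A configuration is branching if its current state has already been visited. -/
def Branching (c : Config Q A) : Prop := c.state ∈ c.mem

/-- Applying an option `(a, q')` to a configuration: move to `q'`, record action `a`
for the departed state, and mark the departed state as visited. -/
noncomputable def apply (c : Config Q A) (a : A) (q' : Q) : Config Q A :=
  letI := Classical.decEq Q
  ⟨q', Function.update c.pol c.state a, c.mem ∪ {c.state}⟩

end Config

/-- A transition: a four-tuple (source configuration, action, chosen successor
state, target configuration). -/
structure Step (Q A : Type) where
  src : Config Q A
  act : A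
  nxt : Q
  tgt : Config Q A

namespace NavTask

variable {Q A : Type}

/-- The options of a configuration: all actions if branching, otherwise only
the action given by the policy, paired with possible successor states. -/
def opts (T : NavTask Q A) (c : Config Q A) : Set (A × Q) :=
  {p | (c.Branching ∨ p.1 = c.pol c.state) ∧ p.2 ∈ T.delta c.state p.1}

/-- Validity of a transition. -/
def ValidStep (T : NavTask Q A) (t : Step Q A) : Prop :=
  (t.act, t.nxt) ∈ T.opts t.src ∧ t.tgt = t.src.apply t.act t.nxt

/-- A reward transition. -/
def IsRewardStep (T : NavTask Q A) (t : Step Q A) : Prop :=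
  (t.src.state, t.act) ∈ T.rewards

end NavTask

/-- A finite list of transitions is a chain: each target is the next source. -/
def IsChainList {Q A : Type} (l : List (Step Q A)) : Prop :=
  ∀ i (h : i + 1 < l.length),
    (l[i]'(Nat.lt_of_succ_lt h)).tgt = (l[i + 1]'h).src

/-- The first (source) configuration of a finite chain, if any. -/
def firstSrc? {Q A : Type} (l : List (Step Q A)) : Option (Config Q A) :=
  l.head?.map Step.src

/-- The last (target, i.e. terminal) configuration of a finite chain, if any. -/
def lastTgt? {Q A : Type} (l : List (Step Q A)) : Option (Config Q A) :=
  l.getLast?.map Step.tgt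

namespace NavTask

variable {Q A : Type}

/-- A finite trial: a nonempty valid chain ending with a reward transition and
containing no other reward transitions. -/
def IsFinTrial (T : NavTask Q A) (l : List (Step Q A)) : Prop :=
  l ≠ [] ∧ IsChainList l ∧ (∀ t ∈ l, T.ValidStep t) ∧
  (∀ t ∈ l.getLast?, T.IsRewardStep t) ∧
  (∀ i (h : i + 1 < l.length), ¬ T.IsRewardStep (l[i]'(Nat.lt_of_succ_lt h)))

/-- An infinite trial: an infinite valid chain with no reward transitions. -/
def IsInfTrial (T : NavTask Q A) (g : ℕ → Step Q A) : Prop :=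
  (∀ n, T.ValidStep (g n)) ∧ (∀ n, (g n).tgt = (g (n + 1)).src) ∧
  (∀ n, ¬ T.IsRewardStep (g n))

/-- A start configuration: a start state with empty working memory. -/
def IsStartConfig (T : NavTask Q A) (c : Config Q A) : Prop :=
  c.state ∈ T.start ∧ c.mem = ∅

/-- When a trial ends with `c₁`, the next trial starts with a configuration `c₂`
whose state is a start state, with the same policy, and empty working memory. -/
def Succession (T : NavTask Q A) (c₁ c₂ : Config Q A) : Prop :=
  c₂.state ∈ T.start ∧ c₂.pol = c₁.pol ∧ c₂.mem = ∅

end NavTask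

/-- A trial is either a finite or an infinite chain of transitions. -/
inductive Trial (Q A : Type) where
  | fin : List (Step Q A) → Trial Q A
  | inf : (ℕ → Step Q A) → Trial Q A

namespace Trial

variable {Q A : Type}

/-- A trial is finite (terminates). -/
def IsFinite : Trial Q A → Prop
  | .fin _ => True
  | .inf _ => False

/-- The configuration occurring at (0-based) position `n` of a trial: sources of
the transitions, plus (for a finite trial) the terminal configuration. -/
def config? : Trial Q A → ℕ → Option (Config Q A)
  | .fin l, n =>
      if h : n < l.length then some (l[n]'h).src
      else if n = l.length then lastTgt? l else none
  | .inf g, n => some (g n).src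

/-- Position `n` of a trial is non-terminal. -/
def NonTerminal : Trial Q A → ℕ → Prop
  | .fin l, n => n < l.length
  | .inf _, _ => True

/-- The positions at which state `q` occurs in a trial. -/
def stateOccs (tr : Trial Q A) (q : Q) : Set ℕ :=
  {n | ∃ c ∈ tr.config? n, c.state = q}

end Trial

/-- Validity of a trial. -/
def NavTask.IsTrial {Q A : Type} (T : NavTask Q A) : Trial Q A → Prop
  | .fin l => T.IsFinTrial l
  | .inf g => T.IsInfTrial g

/-- A run: either an infinite sequence of finite trials, or finitely many finite
trials followed by one infinite trial. -/
inductive Run (Q A : Type) where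
  | allFin : (ℕ → List (Step Q A)) → Run Q A
  | withInf : List (List (Step Q A)) → (ℕ → Step Q A) → Run Q A

/-- Validity of a run on a task. -/
def NavTask.IsRun {Q A : Type} (T : NavTask Q A) : Run Q A → Prop
  | .allFin f =>
      (∀ n, T.IsFinTrial (f n)) ∧
      (∀ c ∈ firstSrc? (f 0), T.IsStartConfig c) ∧
      (∀ n, ∀ c₁ ∈ lastTgt? (f n), ∀ c₂ ∈ firstSrc? (f (n + 1)), T.Succession c₁ c₂) ∧
      (∀ q ∈ T.start, {n | ∃ c ∈ firstSrc? (f n), c.state = q}.Infinite)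
  | .withInf L g =>
      (∀ l ∈ L, T.IsFinTrial l) ∧ T.IsInfTrial g ∧
      (L = [] → T.IsStartConfig (g 0).src) ∧
      (∀ l ∈ L.head?, ∀ c ∈ firstSrc? l, T.IsStartConfig c) ∧
      (∀ i (h : i + 1 < L.length),
        ∀ c₁ ∈ lastTgt? (L[i]'(Nat.lt_of_succ_lt h)),
        ∀ c₂ ∈ firstSrc? (L[i + 1]'h), T.Succession c₁ c₂) ∧
      (∀ c₁ ∈ lastTgt? (L.getLast?.getD []), T.Succession c₁ (g 0).src)

namespace Run

variable {Q A : Type}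

/-- The trials of a run. -/
def trials : Run Q A → Set (Trial Q A)
  | .allFin f => {tr | ∃ n, tr = .fin (f n)}
  | .withInf L g => {tr | (∃ l ∈ L, tr = .fin l) ∨ tr = .inf g}

/-- `P` holds at infinitely many transitions (equivalently, non-terminal
configuration occurrences) of the run, restricted to trials of index `≥ i`. -/
def InfOftenFrom : Run Q A → ℕ → (Step Q A → Prop) → Prop
  | .allFin f, i, P =>
      {p : ℕ × ℕ | i ≤ p.1 ∧ ∃ h : p.2 < (f p.1).length, P ((f p.1)[p.2]'h)}.Infinite
  | .withInf L g, i, P => i ≤ L.length ∧ {n | P (g n)}.Infinite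

/-- `P` holds at infinitely many transitions of the run. -/
def InfOften (R : Run Q A) (P : Step Q A → Prop) : Prop := R.InfOftenFrom 0 P

/-- A state is stable: only finitely many non-terminal occurrences of branching
configurations containing it. -/
def Stable (R : Run Q A) (q : Q) : Prop :=
  ¬ R.InfOften (fun t => t.src.state = q ∧ t.src.Branching)

/-- All trials of the run are finite. -/
def AllFinite : Run Q A → Prop
  | .allFin _ => True
  | .withInf _ _ => False

/-- A run converges: all trials terminate (with reward) and every state
eventually becomes stable. -/
def Converges (R : Run Q A) : Prop := R.AllFinite ∧ ∀ q, R.Stable q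

/-- Only finitely many trials contain more than `k` non-terminal configurations;
equivalently, from some trial index on, every trial has at most `k`
non-terminal configurations (sources of transitions). -/
def EventuallyBounded : Run Q A → ℕ → Prop
  | .allFin f, k => {n | k < (f n).length}.Finite
  | .withInf _ _, _ => False

/-- After trial `i` there are no more branching configurations at
non-terminal positions. -/
def NoBranchingAfter : Run Q A → ℕ → Prop
  | .allFin f, i => ∀ m, i < m → ∀ t ∈ f m, ¬ t.src.Branching
  | .withInf L g, i =>
      (∀ m, i < m → ∀ l ∈ L[m]?, ∀ t ∈ l, ¬ t.src.Branching) ∧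
      (i < L.length → ∀ n, ¬ (g n).src.Branching)

/-- Trial `i` of the run terminates (is finite). -/
def TrialTerminates : Run Q A → ℕ → Prop
  | .allFin _, _ => True
  | .withInf L _, i => i < L.length

/-- `i` is the convergence-trial index: the smallest trial index such that trial `i`
terminates and after trial `i` there are no branching configurations at
non-terminal positions. -/
def IsConvIndex (R : Run Q A) (i : ℕ) : Prop :=
  R.TrialTerminates i ∧ R.NoBranchingAfter i ∧
  ∀ j < i, ¬ (R.TrialTerminates j ∧ R.NoBranchingAfter j)

/-- `π` is the policy at the end of trial `i` of the run. -/
def EndPolicyAt : Run Q A → ℕ → (Q → A) → Prop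
  | .allFin f, i, π => ∃ t ∈ (f i).getLast?, t.tgt.pol = π
  | .withInf L _, i, π => ∃ l ∈ L[i]?, ∃ t ∈ l.getLast?, t.tgt.pol = π

/-- `π` is the final policy of the run: the policy at the end of the
convergence-trial. -/
def IsFinalPolicy (R : Run Q A) (π : Q → A) : Prop :=
  ∃ i, R.IsConvIndex i ∧ R.EndPolicyAt i π

/-- `π` occurs in the run at the end of some trial. -/
def EndsPolicy (R : Run Q A) (π : Q → A) : Prop := ∃ i, R.EndPolicyAt i π

end Run

namespace NavTask

variable {Q A : Type}

/-- Fairness: every configuration occurring infinitely often at non-terminal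
positions has each of its options taken infinitely often. -/
def Fair (T : NavTask Q A) (R : Run Q A) : Prop :=
  ∀ c : Config Q A, R.InfOften (fun t => t.src = c) →
    ∀ p ∈ T.opts c,
      R.InfOften (fun t => t = ⟨c, p.1, p.2, c.apply p.1 p.2⟩)

/-- A task is learnable under fairness if every fair run on it converges. -/
def Learnable (T : NavTask Q A) : Prop :=
  ∀ R : Run Q A, T.IsRun R → T.Fair R → R.Converges

/-- `ground π`: goal states assigned a rewarding action by the policy. -/
def ground (T : NavTask Q A) (π : Q → A) : Set Q := {q | (q, π q) ∈ T.rewards}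

/-- The forward layers of a policy; `fwd π 0` is `F₁ = Q₀` of the paper. -/
def fwd (T : NavTask Q A) (π : Q → A) : ℕ → Set Q
  | 0 => T.start
  | n + 1 => T.fwd π n ∪ ⋃ q ∈ T.fwd π n \ T.ground π, T.delta q (π q)

/-- `forward π`: states reachable from the start states by following `π`. -/
def forward (T : NavTask Q A) (π : Q → A) : Set Q := ⋃ n, T.fwd π n

/-- The backward layers of a policy; `bwd π 0` is `B₁ = ground(π)` of the paper. -/
def bwd (T : NavTask Q A) (π : Q → A) : ℕ → Set Q
  | 0 => T.ground π
  | n + 1 => T.bwd π n ∪ {q | T.delta q (π q) ⊆ T.bwd π n}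

/-- `backward π`: states reduced by `π` to the goal states in `ground π`. -/
def backward (T : NavTask Q A) (π : Q → A) : Set Q := ⋃ n, T.bwd π n

/-- A (simple) path from `q` to `q'`: non-reward transitions, pairwise distinct
states. -/
def Path (T : NavTask Q A) (q q' : Q) : Prop :=
  ∃ (n : ℕ) (s : ℕ → Q) (a : ℕ → A),
    s 0 = q ∧ s n = q' ∧
    (∀ i < n, s (i + 1) ∈ T.delta (s i) (a i)) ∧
    (∀ i < n, (s i, a i) ∉ T.rewards) ∧
    (∀ i ≤ n, ∀ j ≤ n, i ≠ j → s i ≠ s j)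

/-- A state is reachable: there is a path from some start state to it. -/
def Reachable (T : NavTask Q A) (q : Q) : Prop := ∃ q₀ ∈ T.start, T.Path q₀ q

/-- A state has a path to a set `S`. -/
def HasPathTo (T : NavTask Q A) (q : Q) (S : Set Q) : Prop := ∃ q' ∈ S, T.Path q q'

end NavTask

namespace NavTask

variable {Q A : Type}

theorem monotone_bwd (T : NavTask Q A) (π : Q → A) : Monotone (T.bwd π) :=
  monotone_nat_of_le_succ fun _ => Set.subset_union_left

theorem ground_subset_backward (T : NavTask Q A) (π : Q → A) :
    T.ground π ⊆ T.backward π :=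
  Set.subset_iUnion (T.bwd π) 0

/-- `forward π` is closed under following `π` outside `ground π`. -/
theorem delta_subset_forward (T : NavTask Q A) (π : Q → A) {q : Q}
    (hq : q ∈ T.forward π) (hg : q ∉ T.ground π) : T.delta q (π q) ⊆ T.forward π := by
  obtain ⟨n, hn⟩ := Set.mem_iUnion.1 hq
  intro p hp
  exact Set.mem_iUnion.2 ⟨n + 1, Or.inr (Set.mem_biUnion ⟨hn, hg⟩ hp)⟩

/-- A state whose successor set under `π` is finite and contained in `backward π`
belongs to `backward π`. -/
theorem mem_backward_of_delta_subset (T : NavTask Q A) (π : Q → A) {q : Q}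
    (hfin : (T.delta q (π q)).Finite) (hq : T.delta q (π q) ⊆ T.backward π) :
    q ∈ T.backward π := by
  obtain ⟨n, hn⟩ := (T.monotone_bwd π).directed_le.exists_mem_subset_of_finset_subset_biUnion
    (s := hfin.toFinset) (by simpa [backward] using hq)
  exact Set.mem_iUnion.2 ⟨n + 1, Or.inr (by simpa using hn)⟩

end NavTask

/-- For every state `q` in `forward(π) \ backward(π)`, the set
`δ(q, π(q))` intersects `forward(π) \ backward(π)`. -/
theorem delta_meets_forward_diff_backward {Q A : Type} [Fintype Q] [Fintype A]
    (T : NavTask Q A) (π : Q → A) :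
    ∀ q ∈ T.forward π \ T.backward π,
      (T.delta q (π q) ∩ (T.forward π \ T.backward π)).Nonempty := by
  rintro q ⟨hf, hb⟩
  obtain ⟨p, hp, hpb⟩ := Set.not_subset.1
    (mt (T.mem_backward_of_delta_subset π (Set.toFinite _)) hb)
  exact ⟨p, hp, T.delta_subset_forward π hf
    (fun hg => hb (T.ground_subset_backward π hg)) hp, hpb⟩
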